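/- Octahedral Tucker lemma: Let n ≥ 1 and let 𝒰 = {(A,B) : A, B ⊆ [n], A ∩ B = ∅, A ∪ B ≠ ∅}. Suppose λ : 𝒰 → {−(n−1),…,−1, 1,…, n−1} satisfies λ(S,T) = −λ(T,S) for all (S,T) ∈ 𝒰. Then there exist (S₁,T₁), (S₂,T₂) ∈ 𝒰 with S₁ ⊆ S₂ and T₁ ⊆ T₂ such that λ(S₁,T₁) = −λ(S₂,T₂). -/

import Mathlib

open Finset

namespace OctTucker

/-- Sum over all faces obtained by deleting one entry. -/
def dd : (List ℤ → ZMod 2) → List ℤ → ZMod 2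
  | _, [] => 0
  | F, x :: L => F L + dd (fun M => F (x :: M)) L

theorem dd_add (L : List ℤ) : ∀ F G : List ℤ → ZMod 2,
    dd (fun M => F M + G M) L = dd F L + dd G L := by
  induction L with
  | nil => intro F G; simp [dd]
  | cons x L ih => intro F G; simp only [dd]; rw [ih]; ring

theorem dd_zero (L : List ℤ) : dd (fun _ => 0) L = 0 := by
  induction L with
  | nil => simp [dd]
  | cons x L ih => simp only [dd]; rw [ih]; ring

/-- indicator of alternating signs, with the first sign given -/
def alt : Bool → List ℤ → ZMod 2
  | _, [] => 1
  | b, x :: l => if decide (0 < x) = b then alt (!b) l else 0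

theorem dd_alt (L : List ℤ) : ∀ b, L ≠ [] → dd (alt b) L = alt b L + alt (!b) L := by
  induction L with
  | nil => intro b h; exact absurd rfl h
  | cons x l ih =>
    intro b _
    have h2 : ∀ a : ZMod 2, a + a = 0 := CharTwo.add_self_eq_zero
    by_cases hx : decide (0 < x) = b
    · have e1 : (fun M => alt b (x :: M)) = alt (!b) := by
        funext M; simp [alt, hx]
      have e2 : ¬ (decide (0 < x) = !b) := by rw [hx]; cases b <;> simp
      simp only [dd, e1]
      rw [show alt b (x :: l) = alt (!b) l by simp only [alt, if_pos hx],
        show alt (!b) (x :: l) = 0 by simp only [alt, if_neg e2]]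
      cases l with
      | nil => simp [dd, alt]
      | cons y l =>
        rw [ih (!b) (by simp), Bool.not_not]
        linear_combination h2 (alt b (y :: l))
    · have e1 : (fun M => alt b (x :: M)) = fun _ => 0 := by
        funext M; simp only [alt, if_neg hx]
      have e2 : decide (0 < x) = !b := by revert hx; cases b <;> simp
      simp only [dd, e1, dd_zero]
      rw [show alt b (x :: l) = 0 by simp only [alt, if_neg hx],
        show alt (!b) (x :: l) = alt b l by simp only [alt, if_pos e2, Bool.not_not]]
      ring

/-- insertion by absolute value -/
def ins (x : ℤ) : List ℤ → List ℤ
  | [] => [x]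
  | y :: M => if |x| ≤ |y| then x :: y :: M else y :: ins x M

def srt : List ℤ → List ℤ
  | [] => []
  | x :: L => ins x (srt L)

abbrev Sd (L : List ℤ) : Prop := L.Pairwise (fun a b => |a| ≤ |b|)

theorem ins_perm (x : ℤ) (M : List ℤ) : (ins x M).Perm (x :: M) := by
  induction M with
  | nil => simp [ins]
  | cons y M ih =>
    simp only [ins]
    split_ifs
    · exact List.Perm.refl _
    · exact (ih.cons y).trans (List.Perm.swap _ _ _)

theorem srt_perm (M : List ℤ) : (srt M).Perm M := by
  induction M with
  | nil => simp [srt]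
  | cons y M ih => exact (ins_perm _ _).trans (ih.cons y)

theorem ins_sd (x : ℤ) (M : List ℤ) (h : Sd M) : Sd (ins x M) := by
  induction M with
  | nil => simp [ins, Sd]
  | cons y M ih =>
    have h' := List.pairwise_cons.1 h
    simp only [ins]
    split_ifs with hxy
    · refine List.pairwise_cons.2 ⟨?_, h⟩
      intro z hz
      rcases List.mem_cons.1 hz with rfl | hz
      · exact hxy
      · exact hxy.trans (h'.1 z hz)
    · refine List.pairwise_cons.2 ⟨?_, ih h'.2⟩
      intro z hz
      rcases List.mem_cons.1 ((ins_perm x M).mem_iff.1 hz) with rfl | hz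
      · exact (not_le.1 hxy).le
      · exact h'.1 z hz

theorem srt_sd (M : List ℤ) : Sd (srt M) := by
  induction M with
  | nil => simp [srt, Sd]
  | cons y M ih => exact ins_sd _ _ ih

theorem dd_ins (x : ℤ) (M : List ℤ) : ∀ F : List ℤ → ZMod 2, Sd M →
    dd F (ins x M) = F M + dd (fun N => F (ins x N)) M := by
  induction M with
  | nil => intro F _; simp [ins, dd]
  | cons y M ih =>
    intro F h
    have h' := List.pairwise_cons.1 h
    by_cases hxy : |x| ≤ |y|
    · have e : ins x M = x :: M := by
        cases M with
        | nil => rfl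
        | cons z M =>
          have : |x| ≤ |z| := hxy.trans (h'.1 z (by simp))
          simp [ins, this]
      simp only [ins, if_pos hxy, dd, e]
    · simp only [ins, if_neg hxy, dd]
      rw [ih _ h'.2]
      ring

theorem dd_srt (L : List ℤ) : ∀ F : List ℤ → ZMod 2,
    dd (fun M => F (srt M)) L = dd F (srt L) := by
  induction L with
  | nil => intro F; simp [srt, dd]
  | cons x L ih =>
    intro F
    simp only [srt, dd]
    rw [dd_ins _ _ _ (srt_sd L), ih (fun M => F (ins x M))]

theorem ins_neg (x : ℤ) (M : List ℤ) :
    ins (-x) (M.map (fun z => -z)) = (ins x M).map (fun z => -z) := by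
  induction M with
  | nil => simp [ins]
  | cons y M ih =>
    simp only [ins, List.map_cons, abs_neg]
    split_ifs
    · simp
    · simp [ih]

theorem srt_neg (M : List ℤ) : srt (M.map (fun z => -z)) = (srt M).map (fun z => -z) := by
  induction M with
  | nil => simp [srt]
  | cons y M ih => simp only [srt, List.map_cons, ih, ins_neg]

theorem alt_neg (L : List ℤ) : ∀ b, (∀ x ∈ L, x ≠ 0) →
    alt b (L.map (fun z => -z)) = alt (!b) L := by
  induction L with
  | nil => intro b _; simp [alt]
  | cons x L ih =>
    intro b h
    have hx : x ≠ 0 := h x (by simp)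
    have e : (decide (0 < -x) = b) ↔ (decide (0 < x) = !b) := by
      rcases lt_or_gt_of_ne hx with h | h
      · have h1 : 0 < -x := by omega
        have h2 : ¬ 0 < x := by omega
        simp only [h1, h2]; cases b <;> simp
      · have h1 : ¬ 0 < -x := by omega
        simp only [h1, h]; cases b <;> simp
    simp only [List.map_cons, alt, e]
    rw [ih _ (fun z hz => h z (by simp [hz]))]

/-- strictness -/
theorem alt_strict (L : List ℤ) : ∀ b, alt b L ≠ 0 → Sd L → (∀ x ∈ L, x ≠ 0) →
    (∀ x ∈ L, ∀ y ∈ L, x ≠ -y) → L.Pairwise (fun a b => |a| < |b|) := by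
  induction L with
  | nil => intros; simp
  | cons x L ih =>
    intro b hb hs h0 hc
    have hs' := List.pairwise_cons.1 hs
    have hb1 : decide (0 < x) = b := by
      by_contra hne
      exact hb (by simp only [alt, if_neg hne])
    have hb2 : alt (!b) L ≠ 0 := by
      simpa only [alt, if_pos hb1] using hb
    have hP := ih _ hb2 hs'.2 (fun z hz => h0 z (by simp [hz]))
      (fun z hz w hw => hc z (by simp [hz]) w (by simp [hw]))
    refine List.pairwise_cons.2 ⟨?_, hP⟩
    cases L with
    | nil => simp
    | cons y L =>
      have hy1 : decide (0 < y) = !b := by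
        by_contra hne
        exact hb2 (by simp only [alt, if_neg hne])
      have hxy : |x| < |y| := by
        refine lt_of_le_of_ne (hs'.1 y (by simp)) ?_
        intro he
        rcases abs_eq_abs.1 he with h | h
        · rw [h] at hb1; rw [hb1] at hy1; cases b <;> simp at hy1
        · exact hc x (by simp) y (by simp) h
      intro z hz
      rcases List.mem_cons.1 hz with rfl | hz
      · exact hxy
      · exact hxy.trans ((List.pairwise_cons.1 hP).1 z hz)

variable {α : Type} [DecidableEq α]

/-- Sum of `F` over all flags (label lists) of length `k` going down from `U`. -/
def T (l : Finset α → ℤ) : ℕ → Finset α → (List ℤ → ZMod 2) → ZMod 2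
  | 0, _, F => F []
  | k + 1, U, F => ∑ i ∈ U, T l k (U.erase i) (fun L => F (l U :: L))

theorem T_add (l : Finset α → ℤ) (k : ℕ) : ∀ U F G,
    T l k U (fun L => F L + G L) = T l k U F + T l k U G := by
  induction k with
  | zero => intros; simp [T]
  | succ k ih =>
    intro U F G
    simp only [T, ← Finset.sum_add_distrib]
    exact Finset.sum_congr rfl fun i _ => ih _ _ _

theorem sum_erase_erase (g : Finset α → ZMod 2) (U : Finset α) :
    ∑ i ∈ U, ∑ j ∈ U.erase i, g ((U.erase i).erase j) = 0 := by
  rw [Finset.sum_sigma']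
  refine Finset.sum_involution (fun p _ => ⟨p.2, p.1⟩) ?_ ?_ ?_ ?_
  · rintro ⟨i, j⟩ _
    simp only
    rw [Finset.erase_right_comm]
    exact CharTwo.add_self_eq_zero _
  · rintro ⟨i, j⟩ h _ he
    simp only [Finset.mem_sigma, Finset.mem_erase] at h
    simp only [Sigma.mk.injEq] at he
    exact h.2.1 he.1
  · rintro ⟨i, j⟩ h
    simp only [Finset.mem_sigma, Finset.mem_erase] at h ⊢
    exact ⟨h.2.2, Ne.symm h.2.1, h.1⟩
  · rintro ⟨i, j⟩ h
    rfl

theorem T_dd (l : Finset α → ℤ) (k : ℕ) : ∀ U F,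
    T l (k + 1) U (dd F) = ∑ i ∈ U, T l k (U.erase i) F := by
  induction k with
  | zero => intro U F; simp [T, dd]
  | succ k ih =>
    intro U F
    rw [T]
    simp only [dd]
    simp only [T_add, Finset.sum_add_distrib]
    simp only [ih]
    rw [sum_erase_erase (fun V => T l k V (fun M => F (l U :: M)))]
    simp

theorem T_congr (l l' : Finset α → ℤ) (g : ℤ → ℤ) (k : ℕ) : ∀ U F,
    (∀ V ⊆ U, V.Nonempty → l' V = g (l V)) →
    T l' k U F = T l k U (fun L => F (L.map g)) := by
  induction k with
  | zero => intros; simp [T]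
  | succ k ih =>
    intro U F h
    simp only [T, List.map_cons]
    refine Finset.sum_congr rfl fun i hi => ?_
    rw [ih _ _ (fun V hV hn => h V (hV.trans (Finset.erase_subset _ _)) hn),
      h U subset_rfl ⟨i, hi⟩]

theorem T_exists (l : Finset α → ℤ) (k : ℕ) : ∀ U F, T l k U F ≠ 0 →
    ∃ C : List (Finset α), C.length = k ∧ C.Pairwise (fun a b => b ⊆ a) ∧
      (∀ V ∈ C, V.Nonempty ∧ V ⊆ U) ∧ F (C.map l) ≠ 0 := by
  induction k with
  | zero => intro U F h; exact ⟨[], rfl, by simp, by simp, by simpa [T] using h⟩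
  | succ k ih =>
    intro U F h
    rw [T] at h
    obtain ⟨i, hi, hne⟩ := Finset.exists_ne_zero_of_sum_ne_zero h
    obtain ⟨C, hl, hp, hV, hF⟩ := ih _ _ hne
    refine ⟨U :: C, by simp [hl], List.pairwise_cons.2 ⟨?_, hp⟩, ?_, by simpa using hF⟩
    · intro V hVC
      exact (hV V hVC).2.trans (Finset.erase_subset _ _)
    · intro V hVC
      rcases List.mem_cons.1 hVC with rfl | hVC
      · exact ⟨⟨i, hi⟩, subset_rfl⟩
      · exact ⟨(hV V hVC).1, (hV V hVC).2.trans (Finset.erase_subset _ _)⟩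

/-- `T` only depends on `F` on lists of length `k` with labels of nonempty sets. -/
theorem T_congr_fun (l : Finset α → ℤ) (k : ℕ) (U : Finset α) (F G : List ℤ → ZMod 2)
    (h : ∀ C : List (Finset α), C.length = k → (∀ V ∈ C, V.Nonempty) →
      F (C.map l) = G (C.map l)) : T l k U F = T l k U G := by
  by_contra hne
  have : T l k U (fun L => F L + G L) ≠ 0 := by
    rw [T_add]
    intro h0
    exact hne (CharTwo.add_eq_zero.1 h0)
  obtain ⟨C, hl, -, hV, hF⟩ := T_exists l k U _ this
  apply hF
  rw [h C hl (fun V hV' => (hV V hV').1)]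
  exact CharTwo.add_self_eq_zero _

def lab (lam : Finset α → Finset α → ℤ) (P V : Finset α) : ℤ := lam (V ∩ P) (V \ P)

def pos (b : Bool) (L : List ℤ) : ZMod 2 := alt b (srt L)

theorem T_pos (l : Finset α → ℤ) (k : ℕ) (U : Finset α) :
    T l (k + 1) U (pos true) + T l (k + 1) U (pos false)
      = ∑ i ∈ U, T l k (U.erase i) (pos true) := by
  rw [← T_dd, ← T_add]
  refine T_congr_fun _ _ _ _ _ ?_
  intro C hC _
  have hs : srt (C.map l) ≠ [] := by
    intro h
    have := (srt_perm (C.map l)).length_eq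
    rw [h] at this
    simp [hC] at this
  have e := dd_srt (C.map l) (alt true)
  rw [dd_alt _ _ hs] at e
  exact e.symm

theorem main (lam : Finset α → Finset α → ℤ)
    (h0 : ∀ A B : Finset α, Disjoint A B → (A ∪ B).Nonempty → lam A B ≠ 0)
    (hanti : ∀ A B : Finset α, Disjoint A B → (A ∪ B).Nonempty → lam A B = -lam B A)
    (U : Finset α) :
    ∑ P ∈ U.powerset, T (lab lam P) U.card U (pos true) = 1 := by
  have hdisj : ∀ V P : Finset α, Disjoint (V ∩ P) (V \ P) := fun V P =>
    (Finset.disjoint_sdiff_inter V P).symm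
  have hun : ∀ V P : Finset α, V.Nonempty → ((V ∩ P) ∪ (V \ P)).Nonempty := fun V P h => by
    rwa [Finset.union_comm, Finset.sdiff_union_inter]
  induction U using Finset.induction_on with
  | empty => simp [T, pos, srt, alt]
  | insert a U ha ih =>
    rw [Finset.sum_powerset_insert ha, Finset.card_insert_of_notMem ha]
    have e1 : ∑ P ∈ U.powerset, T (lab lam (insert a P)) (U.card + 1) (insert a U) (pos true)
        = ∑ P ∈ U.powerset, T (lab lam P) (U.card + 1) (insert a U) (pos false) := by
      refine Finset.sum_bij' (fun P _ => U \ P) (fun P _ => U \ P) ?_ ?_ ?_ ?_ ?_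
      · intro P _; simp
      · intro P _; simp
      · intro P hP; simpa using Finset.mem_powerset.1 hP
      · intro P hP; simpa using Finset.mem_powerset.1 hP
      · intro P hP
        have hP := Finset.mem_powerset.1 hP
        rw [T_congr (lab lam (U \ P)) (lab lam (insert a P)) (fun z => -z)]
        · refine T_congr_fun _ _ _ _ _ ?_
          intro C _ hC
          simp only [pos]
          rw [srt_neg, alt_neg]
          · rfl
          · intro x hx
            obtain ⟨V, hV, rfl⟩ := List.mem_map.1 ((srt_perm _).mem_iff.1 hx)
            exact h0 _ _ (hdisj _ _) (hun _ _ (hC V hV))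
        · intro V hV hn
          simp only [lab]
          rw [hanti _ _ (hdisj _ _) (hun _ _ hn)]
          have a1 : V \ insert a P = V ∩ (U \ P) := by
            ext z
            have := @hV z
            simp only [Finset.mem_sdiff, Finset.mem_inter, Finset.mem_insert] at *
            by_cases hz : z = a
            · subst hz; tauto
            · tauto
          have a2 : V ∩ insert a P = V \ (U \ P) := by
            ext z
            have := @hV z
            have := @hP z
            simp only [Finset.mem_sdiff, Finset.mem_inter, Finset.mem_insert] at *
            by_cases hz : z = a
            · subst hz; tauto
            · tauto
          rw [a1, a2]
    rw [e1, ← Finset.sum_add_distrib]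
    simp only [T_pos]
    simp only [Finset.sum_insert ha, Finset.erase_insert ha, Finset.sum_add_distrib, ih]
    rw [Finset.sum_comm, Finset.sum_eq_zero, add_zero]
    intro i hi
    obtain ⟨W, hW, rfl⟩ : ∃ W, i ∉ W ∧ insert i W = U :=
      ⟨U.erase i, by simp, Finset.insert_erase hi⟩
    rw [Finset.sum_powerset_insert hW, ← Finset.sum_add_distrib]
    refine Finset.sum_eq_zero fun P _ => ?_
    rw [T_congr (lab lam P) (lab lam (insert i P)) id]
    · simp only [List.map_id]
      exact CharTwo.add_self_eq_zero _
    · intro V hV _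
      have hiV : i ∉ V := fun h => by simpa using hV h
      simp only [lab, id]
      rw [Finset.inter_insert_of_notMem hiV]
      congr 1
      ext z
      simp only [Finset.mem_sdiff, Finset.mem_insert]
      constructor
      · tauto
      · rintro ⟨h1, h2⟩
        refine ⟨h1, ?_⟩
        rintro (rfl | h)
        · exact hiV h1
        · exact h2 h

end OctTucker

open OctTucker in
theorem stmt12 (n : ℕ) (hn : 1 ≤ n)
    (lam : Finset (Fin n) → Finset (Fin n) → ℤ)
    (hrange : ∀ A B : Finset (Fin n), Disjoint A B → (A ∪ B).Nonempty →
      1 ≤ |lam A B| ∧ |lam A B| ≤ (n : ℤ) - 1)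
    (hanti : ∀ A B : Finset (Fin n), Disjoint A B → (A ∪ B).Nonempty →
      lam A B = -lam B A) :
    ∃ S₁ T₁ S₂ T₂ : Finset (Fin n),
      Disjoint S₁ T₁ ∧ (S₁ ∪ T₁).Nonempty ∧
      Disjoint S₂ T₂ ∧ (S₂ ∪ T₂).Nonempty ∧
      S₁ ⊆ S₂ ∧ T₁ ⊆ T₂ ∧ lam S₁ T₁ = -lam S₂ T₂ := by
  by_contra hcon
  have hdisj : ∀ V P : Finset (Fin n), Disjoint (V ∩ P) (V \ P) := fun V P =>
    (Finset.disjoint_sdiff_inter V P).symm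
  have hun : ∀ V P : Finset (Fin n), V.Nonempty → ((V ∩ P) ∪ (V \ P)).Nonempty :=
    fun V P h => by rwa [Finset.union_comm, Finset.sdiff_union_inter]
  have hm := main lam (fun A B h1 h2 h => by
    have := (hrange A B h1 h2).1
    rw [h] at this; simp at this) hanti Finset.univ
  obtain ⟨P, -, hP⟩ := Finset.exists_ne_zero_of_sum_ne_zero (by rw [hm]; exact one_ne_zero)
  obtain ⟨C, hl, hp, hV, hF⟩ := T_exists _ _ _ _ hP
  have hmem : ∀ x ∈ srt (C.map (lab lam P)), ∃ V ∈ C, lab lam P V = x := fun x hx =>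
    List.mem_map.1 ((srt_perm _).mem_iff.1 hx)
  have hr : ∀ x ∈ srt (C.map (lab lam P)), 1 ≤ |x| ∧ |x| ≤ (n : ℤ) - 1 := by
    intro x hx
    obtain ⟨V, hVC, rfl⟩ := hmem x hx
    exact hrange _ _ (hdisj _ _) (hun _ _ (hV V hVC).1)
  have hkey : ∀ V ∈ C, ∀ W ∈ C, V ⊆ W → lab lam P V ≠ -lab lam P W := by
    intro V h1 W h2 hs he
    exact hcon ⟨V ∩ P, V \ P, W ∩ P, W \ P, hdisj _ _, hun _ _ (hV V h1).1, hdisj _ _,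
      hun _ _ (hV W h2).1, Finset.inter_subset_inter_right hs,
      Finset.sdiff_subset_sdiff hs subset_rfl, he⟩
  have htot : ∀ V ∈ C, ∀ W ∈ C, V ⊆ W ∨ W ⊆ V := by
    clear hF hmem hr hkey hl hV
    induction C with
    | nil => simp
    | cons X C ih =>
      have hp' := List.pairwise_cons.1 hp
      intro V h1 W h2
      rcases List.mem_cons.1 h1 with rfl | h3 <;> rcases List.mem_cons.1 h2 with rfl | h4
      · exact Or.inl subset_rfl
      · exact Or.inr (hp'.1 _ h4)
      · exact Or.inl (hp'.1 _ h3)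
      · exact ih hp'.2 V h3 W h4
  have hst := alt_strict _ _ hF (srt_sd _)
    (fun x hx h => by have := (hr x hx).1; rw [h] at this; simp at this)
    (by
      intro x hx y hy he
      obtain ⟨V, h1, rfl⟩ := hmem x hx
      obtain ⟨W, h2, rfl⟩ := hmem y hy
      rcases htot V h1 W h2 with h | h
      · exact hkey V h1 W h2 h he
      · exact hkey W h2 V h1 h (by rw [he, neg_neg]))
  have hnd : ((srt (C.map (lab lam P))).map (fun z => |z|)).Nodup :=
    List.pairwise_map.2 (hst.imp fun h => ne_of_lt h)
  have hsub : ((srt (C.map (lab lam P))).map (fun z => |z|)).toFinset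
      ⊆ Finset.Icc 1 ((n : ℤ) - 1) := by
    intro z hz
    obtain ⟨x, hx, rfl⟩ := List.mem_map.1 (List.mem_toFinset.1 hz)
    exact Finset.mem_Icc.2 (hr x hx)
  have hcard := Finset.card_le_card hsub
  rw [List.toFinset_card_of_nodup hnd, List.length_map, (srt_perm _).length_eq,
    List.length_map, hl, Int.card_Icc, Finset.card_univ, Fintype.card_fin] at hcard
  omega
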